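/- Let h > g ≥ 1 be integers and set n = 2h − 1. Let X be a positive definite symmetric real g×g matrix and let A₁, …, A_n be symmetric real g×g matrices. Then the alternating trace vanishes: Σ_{σ ∈ S_n} sgn(σ) · tr(X⁻¹A_{σ(1)} X⁻¹A_{σ(2)} ⋯ X⁻¹A_{σ(n)}) = 0. -/

import Mathlib

open Polynomial in
/-- Jacobi's formula for the characteristic polynomial. -/
theorem Matrix.derivative_charpoly {R n : Type*} [CommRing R] [Fintype n] [DecidableEq n]
    (M : Matrix n n R) : derivative M.charpoly = (adjugate (charmatrix M)).trace := by
  have key (i : n) (σ : Equiv.Perm n) :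
      ∏ j, (charmatrix M).updateCol i (Pi.single i 1) (σ j) j =
        (∏ j ∈ Finset.univ.erase i, charmatrix M (σ j) j) * derivative (charmatrix M (σ i) i) := by
    rw [← Finset.prod_erase_mul _ _ (Finset.mem_univ i)]
    congr 1
    · refine Finset.prod_congr rfl fun j hj => ?_
      rw [updateCol_ne (Finset.ne_of_mem_erase hj)]
    · by_cases h : σ i = i <;> simp [h]
  have hadj (i : n) : adjugate (charmatrix M) i i =
      ((charmatrix M).updateCol i (Pi.single i 1)).det := by
    rw [← transpose_apply (adjugate _), adjugate_transpose, adjugate_apply, updateRow_transpose,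
      det_transpose]
  simp only [trace, diag, hadj, charpoly, det_apply, derivative_sum, derivative_smul,
    derivative_prod_finset, key, Finset.smul_sum]
  exact Finset.sum_comm

open Polynomial in
/-- Over a commutative `ℚ`-algebra, a matrix all of whose positive powers have trace zero has
characteristic polynomial `X ^ card n`, hence is nilpotent. -/
theorem Matrix.pow_card_eq_zero_of_trace_pow_eq_zero {R n : Type*} [CommRing R] [Algebra ℚ R]
    [Fintype n] [DecidableEq n] (M : Matrix n n R) (hM : ∀ k, (M ^ (k + 1)).trace = 0) :
    M ^ Fintype.card n = 0 := by
  nontriviality R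
  set N := matPolyEquiv (adjugate (charmatrix M)) with hN
  have hmul : (X - C M) * N = M.charpoly.map (algebraMap R (Matrix n n R)) := by
    rw [hN, ← matPolyEquiv_charmatrix, ← map_mul, mul_adjugate, ← charpoly,
      matPolyEquiv_smul_one]
  have hrec (k : ℕ) : N.coeff k =
      algebraMap _ _ (M.charpoly.coeff (k + 1)) + M * N.coeff (k + 1) := by
    have := congrArg (coeff · (k + 1)) hmul
    rw [sub_mul, coeff_sub, coeff_X_mul, coeff_C_mul, coeff_map] at this
    rw [← this]; abel
  have hzero : - (M * N.coeff 0) = algebraMap _ _ (M.charpoly.coeff 0) := by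
    have := congrArg (coeff · 0) hmul
    simpa [sub_mul, coeff_sub] using this
  have htr (m : ℕ) : ∀ k j, N.natDegree < k + m → (M ^ (j + 1) * N.coeff k).trace = 0 := by
    induction m with
    | zero =>
      intro k j h
      rw [coeff_eq_zero_of_natDegree_lt (by simpa using h), mul_zero, trace_zero]
    | succ m ih =>
      intro k j h
      rw [hrec, mul_add, trace_add, ← mul_assoc, ← pow_succ, ih _ _ (by omega),
        Algebra.algebraMap_eq_smul_one]
      simp [hM]
  have htr' (k : ℕ) : (M * N.coeff k).trace = 0 := by
    simpa using htr (N.natDegree + 1) k 0 (by omega)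
  have hcoeff (k : ℕ) : (k : R) * M.charpoly.coeff k = Fintype.card n * M.charpoly.coeff k := by
    cases k with
    | zero =>
      have := congrArg trace hzero
      rw [trace_neg, htr', Algebra.algebraMap_eq_smul_one] at this
      simpa [mul_comm] using this
    | succ k =>
      have h1 := congrArg trace (hrec k)
      rw [trace_add, htr', Algebra.algebraMap_eq_smul_one] at h1
      have h2 := congrArg (coeff · k) (derivative_charpoly M)
      simp only [coeff_derivative, trace, diag, finsetSum_coeff, ← matPolyEquiv_coeff_apply] at h2
      rw [← hN] at h2
      simp [trace] at h1
      push_cast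
      rw [mul_comm, h2, h1, mul_comm]
  have hp : M.charpoly = X ^ Fintype.card n := by
    ext k
    rw [coeff_X_pow]
    split_ifs with h
    · rw [h, ← charpoly_natDegree_eq_dim M]
      exact M.charpoly_monic
    · have h0 : ((k - Fintype.card n : ℚ)) • M.charpoly.coeff k = 0 := by
        rw [Algebra.smul_def]; simp [sub_mul, hcoeff]
      refine (smul_eq_zero_iff_right ?_).1 h0
      rw [sub_ne_zero]; exact_mod_cast h
  simpa [hp] using aeval_self_charpoly M

theorem Matrix.trace_mul_self_mul_eq_zero_of_anticommute {A n : Type*} [Ring A] [Algebra ℚ A]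
    [Fintype n] [DecidableEq n] (ω : Matrix n n A)
    (hω : ∀ i j k l, ω i j * ω k l = -(ω k l * ω i j))
    (Z : Matrix n n A) (hZ : ∀ i j k l, Commute (Z i j) (ω k l)) (hZω : Commute Z ω) :
    (ω * ω * Z).trace = 0 := by
  have hanti (i j k l) : ω i j * (ω * Z) k l = -((ω * Z) k l * ω i j) := by
    simp only [mul_apply, Finset.mul_sum, Finset.sum_mul, ← Finset.sum_neg_distrib]
    refine Finset.sum_congr rfl fun r _ => ?_
    rw [mul_assoc, (hZ r l i j).eq, ← mul_assoc, ← mul_assoc, hω, neg_mul]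
  have h : (ω * ω * Z).trace = -(ω * ω * Z).trace := by
    conv_rhs => rw [mul_assoc, ← hZω.eq, ← mul_assoc]
    rw [mul_assoc, trace, trace]
    simp only [diag, mul_apply (M := ω) (N := ω * Z), mul_apply (M := ω * Z) (N := ω), hanti,
      Finset.sum_neg_distrib]
    rw [Finset.sum_comm]
  rw [eq_neg_iff_add_eq_zero, ← two_nsmul, ← Nat.cast_smul_eq_nsmul ℚ] at h
  exact (smul_eq_zero_iff_right (by norm_num)).1 h

open scoped IsMulCommutative in
/-- A square matrix with pairwise anticommuting entries is nilpotent. -/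
theorem Matrix.pow_two_mul_card_eq_zero_of_anticommute {A n : Type*} [Ring A] [Algebra ℚ A]
    [Fintype n] [DecidableEq n] (ω : Matrix n n A)
    (hω : ∀ i j k l, ω i j * ω k l = -(ω k l * ω i j)) :
    ω ^ (2 * Fintype.card n) = 0 := by
  have hcomm (i j k l r s) : Commute (ω i j * ω k l) (ω r s) := by
    rw [commute_iff_eq, mul_assoc, hω k l, mul_neg, ← mul_assoc, hω i j, neg_mul, neg_neg,
      mul_assoc]
  let P : Set A := {x | ∃ i j k l, ω i j * ω k l = x}
  have hP : ∀ x ∈ P, ∀ y ∈ P, x * y = y * x := by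
    rintro _ ⟨i, j, k, l, rfl⟩ _ ⟨i', j', k', l', rfl⟩
    exact (hcomm _ _ _ _ _ _).mul_right (hcomm _ _ _ _ _ _)
  let S := Algebra.adjoin ℚ P
  have : IsMulCommutative S := Algebra.isMulCommutative_adjoin ℚ hP
  have hS (x : S) (i j) : Commute (x : A) (ω i j) := by
    have hle : S ≤ Subalgebra.centralizer ℚ {ω i j} := by
      refine Algebra.adjoin_le ?_
      rintro _ ⟨_, _, _, _, rfl⟩
      rintro _ rfl
      exact (hcomm _ _ _ _ i j).symm.eq
    exact ((Subalgebra.mem_centralizer_iff ℚ).1 (hle x.2) _ rfl).symm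
  let M : Matrix n n S := of fun i j => ⟨(ω * ω) i j, by
    rw [mul_apply]
    exact Subalgebra.sum_mem _ fun k _ => Algebra.subset_adjoin ⟨_, _, _, _, rfl⟩⟩
  let φ : Matrix n n S →+* Matrix n n A := S.val.toRingHom.mapMatrix
  have hφ : φ M = ω * ω := rfl
  have hM (k : ℕ) : (M ^ (k + 1)).trace = 0 := by
    apply Subtype.val_injective
    have : ((M ^ (k + 1)).trace : A) = (φ (M ^ (k + 1))).trace :=
      AddMonoidHom.map_trace S.val.toRingHom _
    rw [this, pow_succ', map_mul, hφ]
    refine trace_mul_self_mul_eq_zero_of_anticommute ω hω _ (fun i j k l => hS _ _ _) ?_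
    rw [map_pow, hφ]
    exact ((Commute.refl ω).mul_left (Commute.refl ω)).pow_left k
  have h0 := congrArg φ (M.pow_card_eq_zero_of_trace_pow_eq_zero hM)
  rwa [map_pow, hφ, map_zero, ← pow_two, ← pow_mul] at h0

theorem Matrix.prod_ofFn_smul_map_algebraMap {R A n : Type*} [CommRing R] [Ring A] [Algebra R A]
    [Fintype n] [DecidableEq n] {k : ℕ} (x : Fin k → A) (B : Fin k → Matrix n n R) :
    (List.ofFn fun j => x j • (B j).map (algebraMap R A)).prod =
      (List.ofFn x).prod • (List.ofFn B).prod.map (algebraMap R A) := by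
  induction k with
  | zero => simp
  | succ k ih =>
    simp only [List.ofFn_succ, List.prod_cons, ih, Matrix.map_mul]
    ext i j
    simp only [mul_apply, smul_apply, map_apply, smul_eq_mul, Finset.mul_sum]
    refine Finset.sum_congr rfl fun l _ => ?_
    simp only [mul_assoc]
    rw [Algebra.left_comm (x 0) (B 0 i l), Algebra.left_comm (List.prod _) (B 0 i l),
      Algebra.left_comm (x 0) (B 0 i l)]

/-- The Amitsur-Levitzki theorem over a commutative `ℚ`-algebra. -/
theorem Matrix.sum_sign_smul_prod_eq_zero {R n : Type*} [CommRing R] [Algebra ℚ R]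
    [Fintype n] [DecidableEq n] {m : ℕ} (hm : 2 * Fintype.card n ≤ m) (B : Fin m → Matrix n n R) :
    ∑ σ : Equiv.Perm (Fin m), Equiv.Perm.sign σ • (List.ofFn fun i => B (σ i)).prod = 0 := by
  let e (i : Fin m) : Fin m → R := Pi.single i 1
  let ω : Matrix n n (ExteriorAlgebra R (Fin m → R)) :=
    ∑ i, ExteriorAlgebra.ι R (e i) • (B i).map (algebraMap R _)
  have hω (a b) : ω a b = ExteriorAlgebra.ι R (∑ i, B i a b • e i) := by
    simp only [ω, sum_apply, smul_apply, map_apply, map_sum, map_smul, smul_eq_mul]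
    exact Finset.sum_congr rfl fun i _ => by rw [Algebra.smul_def, Algebra.commutes]
  have hpow : ω ^ m = 0 := by
    refine pow_eq_zero_of_le hm (pow_two_mul_card_eq_zero_of_anticommute ω fun i j k l => ?_)
    rw [hω, hω]
    exact eq_neg_of_add_eq_zero_left (ExteriorAlgebra.ι_add_mul_swap _ _)
  have hsum : ω ^ m = ∑ f : Fin m → Fin m,
      (List.ofFn fun j => ExteriorAlgebra.ι R (e (f j))).prod •
        (List.ofFn fun j => B (f j)).prod.map (algebraMap R _) := by
    rw [← MultilinearMap.mkPiAlgebraFin_apply_const (R := R), MultilinearMap.map_sum]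
    exact Finset.sum_congr rfl fun f _ => prod_ofFn_smul_map_algebraMap _ _
  let φ : ExteriorAlgebra R (Fin m → R) →ₗ[R] R :=
    ExteriorAlgebra.liftAlternating (Pi.single m detRowAlternating)
  have hφ (f : Fin m → Fin m) (c : R) :
      φ ((List.ofFn fun j => ExteriorAlgebra.ι R (e (f j))).prod * algebraMap R _ c) =
        c * ((1 : Matrix (Fin m) (Fin m) R).submatrix f id).det := by
    have he : (1 : Matrix (Fin m) (Fin m) R).submatrix f id = of fun j => e (f j) := by
      ext i j
      simp [e, one_apply, Pi.single_apply, eq_comm]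
    rw [← Algebra.commutes, ← Algebra.smul_def, map_smul, smul_eq_mul, he,
      ← ExteriorAlgebra.ιMulti_apply (R := R) (fun j => e (f j)),
      ExteriorAlgebra.liftAlternating_apply_ιMulti, Pi.single_eq_same]
    rfl
  ext a b
  have hab := congrArg φ (congrFun₂ (hsum.symm.trans hpow) a b)
  simp only [sum_apply, map_sum, smul_apply, smul_eq_mul, map_apply, zero_apply, map_zero,
    hφ] at hab
  rw [zero_apply, ← hab, sum_apply]
  refine Finset.sum_of_injOn (fun σ : Equiv.Perm (Fin m) => (σ : Fin m → Fin m))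
    DFunLike.coe_injective.injOn (fun _ _ => Finset.mem_univ _) (fun f _ hf => ?_) fun σ _ => ?_
  · have : ¬ Function.Injective f := fun hinj => hf
      ⟨Equiv.ofBijective f (Finite.injective_iff_bijective.1 hinj), by simp, rfl⟩
    simp only [Function.Injective, not_forall] at this
    obtain ⟨i, j, hij, hne⟩ := this
    rw [det_zero_of_row_eq hne (funext fun _ => by rw [submatrix_apply, submatrix_apply, hij]),
      mul_zero]
  · rw [det_permute, det_one, mul_one, mul_comm, smul_apply, Units.smul_def, zsmul_eq_mul]

/-- For `h > g ≥ 1` and `n = 2h − 1`, the alternating trace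
`Σ_{σ ∈ S_n} sgn(σ) · tr(X⁻¹A_{σ(1)} ⋯ X⁻¹A_{σ(n)})` vanishes, for `X` a positive definite
symmetric real `g × g` matrix and `A₁, …, A_n` symmetric real `g × g` matrices.
This is the vanishing property `ω^{2h−1}_X = 0` when `X` has rank `g < h`. -/
theorem alternating_trace_vanishes_of_lt
    (g h : ℕ) (hg : 1 ≤ g) (hgh : g < h)
    (X : Matrix (Fin g) (Fin g) ℝ) (hX : X.PosDef)
    (A : Fin (2 * h - 1) → Matrix (Fin g) (Fin g) ℝ) (hA : ∀ i, (A i).IsSymm) :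
    ∑ σ : Equiv.Perm (Fin (2 * h - 1)),
      ((Equiv.Perm.sign σ : ℤ) : ℝ) *
        Matrix.trace (((List.finRange (2 * h - 1)).map fun i => X⁻¹ * A (σ i)).prod) = 0 := by
  have h0 := congrArg Matrix.trace (Matrix.sum_sign_smul_prod_eq_zero (R := ℝ) (m := 2 * h - 1)
    (n := Fin g) (by rw [Fintype.card_fin]; omega) fun i => X⁻¹ * A i)
  simp only [Matrix.trace_sum, Units.smul_def, Matrix.trace_smul, Matrix.trace_zero] at h0
  simpa only [zsmul_eq_mul, List.ofFn_eq_map] using h0
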